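/- For every M > 0, the infimum h_M^r := inf_{ρ ∈ F_M^r} H_C^r(ρ) is strictly negative: h_M^r < 0. -/

import Mathlib

open MeasureTheory Real Filter Topology

noncomputable section

abbrev Space : Type := EuclideanSpace ℝ (Fin 3)

/-- Induced gravitational potential `U_ρ = -ρ ∗ 1/|·|`. -/
def Upot (ρ : Space → ℝ) : Space → ℝ := fun x => - ∫ y : Space, ρ y / ‖x - y‖

/-- Induced gravitational field `∇U_ρ`. -/
def gradU (ρ : Space → ℝ) : Space → Space := fun x => gradient (Upot ρ) x

/-- Potential energy. -/
def Epot (ρ : Space → ℝ) : ℝ :=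
  -(1/2) * ∫ x : Space, ∫ y : Space, ρ x * ρ y / ‖x - y‖

/-- The reduced energy-Casimir functional `H_C^r(ρ) = ∫ Φ(ρ) + E_pot(ρ)`. -/
def HCr (Φ : ℝ → ℝ) (ρ : Space → ℝ) : ℝ := (∫ x : Space, Φ (ρ x)) + Epot ρ

/-- The reduced constraint set `F_M^r = {ρ ∈ L¹₊ : ∫ Φ(ρ) < ∞, ∫ ρ = M}`. -/
def FMr (Φ : ℝ → ℝ) (M : ℝ) : Set (Space → ℝ) :=
  {ρ | (∀ x, 0 ≤ ρ x) ∧ Integrable ρ ∧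
       Integrable (fun x => Φ (ρ x)) ∧ (∫ x : Space, ρ x) = M}

/-- The infimum `h_M^r` of `H_C^r` over `F_M^r`. -/
def hMr (Φ : ℝ → ℝ) (M : ℝ) : ℝ := sInf (HCr Φ '' FMr Φ M)

/-- Assumptions on `Φ`: `Φ ∈ C¹([0,∞))` with derivative `Φ'`, `Φ(0) = Φ'(0) = 0`,
strictly convex, `Φ(r) ≥ C r^{1+1/n}` for large `r` with `0 < n < 3`, and
`Φ(r) ≤ C r^{1+1/n'}` for small `r` with `0 < n' < 3`. -/
structure PhiHyp (Φ Φ' : ℝ → ℝ) (n n' : ℝ) : Prop where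
  n_pos : 0 < n
  n_lt_three : n < 3
  n'_pos : 0 < n'
  n'_lt_three : n' < 3
  hasDeriv : ∀ r ∈ Set.Ici (0:ℝ), HasDerivWithinAt Φ (Φ' r) (Set.Ici 0) r
  contDeriv : ContinuousOn Φ' (Set.Ici 0)
  zero : Φ 0 = 0
  derivZero : Φ' 0 = 0
  strictConvex : StrictConvexOn ℝ (Set.Ici 0) Φ
  growth : ∃ C > (0:ℝ), ∃ r₁ : ℝ, ∀ r : ℝ, r₁ ≤ r → C * r ^ (1 + 1/n) ≤ Φ r
  small : ∃ C > (0:ℝ), ∃ r₁ > (0:ℝ), ∀ r : ℝ, 0 ≤ r → r ≤ r₁ → Φ r ≤ C * r ^ (1 + 1/n')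

theorem PhiHyp.nonneg {Φ Φ' : ℝ → ℝ} {n n' : ℝ} (hΦ : PhiHyp Φ Φ' n n') {t : ℝ} (ht : 0 ≤ t) :
    0 ≤ Φ t := by
  rcases ht.eq_or_lt with rfl | ht
  · exact hΦ.zero.ge
  have h := hΦ.strictConvex.convexOn.le_slope_of_hasDerivWithinAt Set.self_mem_Ici
    (Set.mem_Ici.2 ht.le) ht (hΦ.hasDeriv 0 Set.self_mem_Ici)
  rw [hΦ.derivZero, slope_def_field, hΦ.zero, sub_zero, sub_zero] at h
  simpa [ht.ne'] using mul_nonneg h ht.le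

/-- The kernel `1/r` truncated to `r < R`. -/
def truncInv (R : ℝ) : ℝ → ℝ := (Set.Iio R).indicator (fun r => r⁻¹)

theorem setIntegral_sq_mul_truncInv {R : ℝ} (hR : 0 < R) :
    IntegrableOn (fun r : ℝ => r ^ 2 • truncInv R r) (Set.Ioi 0) ∧
      ∫ r in Set.Ioi (0 : ℝ), r ^ 2 • truncInv R r = R ^ 2 / 2 := by
  have hEq : Set.EqOn (fun r : ℝ => r ^ 2 • truncInv R r)
      ((Set.Iio R).indicator (fun r => r)) (Set.Ioi 0) := by
    intro r hr
    have hr' : r ≠ 0 := ne_of_gt hr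
    by_cases h : r < R
    · simp only [truncInv, Set.mem_Iio, h, Set.indicator_of_mem, smul_eq_mul]
      field_simp
    · simp [truncInv, h]
  have hint : IntegrableOn (fun r : ℝ => r) (Set.Ioo 0 R) :=
    (continuous_id.integrableOn_Icc (a := 0) (b := R)).mono_set Set.Ioo_subset_Icc_self
  constructor
  · rw [integrableOn_congr_fun hEq measurableSet_Ioi, IntegrableOn,
      integrable_indicator_iff measurableSet_Iio, IntegrableOn,
      Measure.restrict_restrict measurableSet_Iio, Set.inter_comm, Set.Ioi_inter_Iio]
    exact hint
  · rw [setIntegral_congr_fun measurableSet_Ioi hEq, setIntegral_indicator measurableSet_Iio,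
      Set.Ioi_inter_Iio, ← integral_Ioc_eq_integral_Ioo,
      ← intervalIntegral.integral_of_le hR.le, integral_id]
    ring

theorem truncInv_nonneg {R r : ℝ} (hr : 0 ≤ r) : 0 ≤ truncInv R r :=
  Set.indicator_apply_nonneg fun _ => inv_nonneg.2 hr

theorem measurable_truncInv (R : ℝ) : Measurable (truncInv R) :=
  measurable_inv.indicator measurableSet_Iio

theorem lintegral_truncInv_norm_sub {R : ℝ} (hR : 0 < R) (x : Space) :
    ∫⁻ y : Space, ENNReal.ofReal (truncInv R ‖x - y‖) =
      ENNReal.ofReal (3 * volume.real (Metric.ball (0 : Space) 1) / 2 * R ^ 2) := by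
  have hd : Module.finrank ℝ Space - 1 = 2 := by simp
  have hint : Integrable (fun z : Space => truncInv R ‖z‖) := by
    rw [integrable_fun_norm_addHaar (volume : Measure Space) (f := truncInv R), hd]
    exact (setIntegral_sq_mul_truncInv hR).1
  rw [lintegral_sub_left_eq_self (fun z : Space => ENNReal.ofReal (truncInv R ‖z‖)) x,
    ← ofReal_integral_eq_lintegral_ofReal hint
      (ae_of_all _ fun z => truncInv_nonneg (norm_nonneg z)),
    integral_fun_norm_addHaar (volume : Measure Space), hd, (setIntegral_sq_mul_truncInv hR).2]
  congr 1
  simp only [finrank_euclideanSpace_fin, nsmul_eq_mul, smul_eq_mul, Nat.cast_ofNat]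
  ring

theorem mul_min_div_le {t s r R : ℝ} (ht : 0 ≤ t) (hs : 0 ≤ s) (hr : 0 ≤ r) (hR : 0 < R) :
    t * min t s / r ≤ t ^ 2 * truncInv R r + t / R * s := by
  by_cases h : r < R
  · have h1 : t * min t s / r ≤ t ^ 2 * r⁻¹ := by
      rw [div_eq_mul_inv, sq]
      gcongr
      exact min_le_left _ _
    have : 0 ≤ t / R * s := by positivity
    simp only [truncInv, Set.mem_Iio, h, Set.indicator_of_mem]
    linarith
  · have h2 : R ≤ r := not_lt.1 h
    have : t * min t s / r ≤ t * s / R := by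
      gcongr
      exact min_le_right _ _
    simp only [truncInv, Set.mem_Iio, h, not_false_iff, Set.indicator_of_notMem]
    linarith [show t / R * s = t * s / R by ring]

theorem lintegral_mul_min_div_le {ρ : Space → ℝ} (h0 : ∀ x, 0 ≤ ρ x) (hρ : Integrable ρ)
    (x : Space) :
    ∫⁻ y : Space, ENNReal.ofReal (ρ x * min (ρ x) (ρ y) / ‖x - y‖) ≤
      ENNReal.ofReal ((3 * volume.real (Metric.ball (0 : Space) 1) / 2 + ∫ y, ρ y) *
        ρ x ^ (4 / 3 : ℝ)) := by
  rcases (h0 x).eq_or_lt with hx | hx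
  · simp [← hx]
  set t := ρ x
  set R : ℝ := t ^ (-(1 / 3) : ℝ)
  have hR : 0 < R := Real.rpow_pos_of_pos hx _
  have e1 : t ^ 2 * R ^ 2 = t ^ (4 / 3 : ℝ) := by
    rw [← Real.rpow_natCast R, ← Real.rpow_mul hx.le, ← Real.rpow_natCast t,
      ← Real.rpow_add hx]
    norm_num
  have e2 : t / R = t ^ (4 / 3 : ℝ) := by
    rw [div_eq_iff hR.ne', ← Real.rpow_add hx]
    norm_num
  have hM : 0 ≤ ∫ y, ρ y := integral_nonneg h0
  have hv : 0 ≤ volume.real (Metric.ball (0 : Space) 1) := measureReal_nonneg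
  have hm : Measurable fun y : Space => ENNReal.ofReal (truncInv R ‖x - y‖) :=
    ((measurable_truncInv R).comp (by fun_prop)).ennreal_ofReal
  calc ∫⁻ y : Space, ENNReal.ofReal (t * min t (ρ y) / ‖x - y‖)
      ≤ ∫⁻ y : Space, (ENNReal.ofReal (t ^ 2) * ENNReal.ofReal (truncInv R ‖x - y‖) +
          ENNReal.ofReal (t / R) * ENNReal.ofReal (ρ y)) := by
        refine lintegral_mono fun y => ?_
        rw [← ENNReal.ofReal_mul (by positivity), ← ENNReal.ofReal_mul (by positivity),
          ← ENNReal.ofReal_add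
            (mul_nonneg (by positivity) (truncInv_nonneg (norm_nonneg _)))
            (mul_nonneg (by positivity) (h0 y))]
        exact ENNReal.ofReal_le_ofReal (mul_min_div_le hx.le (h0 y) (norm_nonneg _) hR)
    _ = ENNReal.ofReal ((3 * volume.real (Metric.ball (0 : Space) 1) / 2 + ∫ y, ρ y) *
        t ^ (4 / 3 : ℝ)) := by
        rw [lintegral_add_left (hm.const_mul _), lintegral_const_mul' _ _ ENNReal.ofReal_ne_top,
          lintegral_const_mul' _ _ ENNReal.ofReal_ne_top, lintegral_truncInv_norm_sub hR,
          ← ofReal_integral_eq_lintegral_ofReal hρ (ae_of_all _ h0),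
          ← ENNReal.ofReal_mul (by positivity), ← ENNReal.ofReal_mul (by positivity),
          ← ENNReal.ofReal_add (by positivity) (by positivity), e2]
        congr 1
        linear_combination (3 * volume.real (Metric.ball (0 : Space) 1) / 2) * e1

theorem lintegral_lintegral_coulomb_le {ρ : Space → ℝ} (h0 : ∀ x, 0 ≤ ρ x)
    (hρ : Integrable ρ) :
    ∫⁻ x : Space, ∫⁻ y : Space, ENNReal.ofReal (ρ x * ρ y / ‖x - y‖) ≤
      ∫⁻ x : Space, ENNReal.ofReal
        (2 * (3 * volume.real (Metric.ball (0 : Space) 1) / 2 + ∫ y, ρ y) *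
          ρ x ^ (4 / 3 : ℝ)) := by
  have hm := hρ.1.aemeasurable
  have m1 : AEMeasurable (fun p : Space × Space => ρ p.1) (volume.prod volume) := hm.comp_fst
  have m2 : AEMeasurable (fun p : Space × Space => ρ p.2) (volume.prod volume) := hm.comp_snd
  have mk : AEMeasurable (fun p : Space × Space =>
      ENNReal.ofReal (ρ p.1 * min (ρ p.1) (ρ p.2) / ‖p.1 - p.2‖)) (volume.prod volume) := by
    fun_prop
  have mk1 (x : Space) : AEMeasurable (fun y : Space =>
      ENNReal.ofReal (ρ x * min (ρ x) (ρ y) / ‖x - y‖)) := by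
    fun_prop
  have step : ∫⁻ x : Space, ∫⁻ y : Space, ENNReal.ofReal (ρ x * min (ρ x) (ρ y) / ‖x - y‖) ≤
      ∫⁻ x : Space, ENNReal.ofReal
        ((3 * volume.real (Metric.ball (0 : Space) 1) / 2 + ∫ y, ρ y) * ρ x ^ (4 / 3 : ℝ)) :=
    lintegral_mono fun x => lintegral_mul_min_div_le h0 hρ x
  calc ∫⁻ x : Space, ∫⁻ y : Space, ENNReal.ofReal (ρ x * ρ y / ‖x - y‖)
      ≤ ∫⁻ x : Space, ∫⁻ y : Space, (ENNReal.ofReal (ρ x * min (ρ x) (ρ y) / ‖x - y‖) +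
          ENNReal.ofReal (ρ y * min (ρ y) (ρ x) / ‖y - x‖)) := by
        refine lintegral_mono fun x => lintegral_mono fun y => ?_
        have hx := h0 x
        have hy := h0 y
        rw [norm_sub_rev y x, min_comm (ρ y),
          ← ENNReal.ofReal_add (by positivity) (by positivity), ← add_div]
        refine ENNReal.ofReal_le_ofReal ?_
        gcongr
        rcases le_total (ρ x) (ρ y) with h | h
        · rw [min_eq_left h]; nlinarith
        · rw [min_eq_right h]; nlinarith
    _ = (∫⁻ x : Space, ∫⁻ y : Space, ENNReal.ofReal (ρ x * min (ρ x) (ρ y) / ‖x - y‖)) +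
          ∫⁻ y : Space, ∫⁻ x : Space, ENNReal.ofReal (ρ y * min (ρ y) (ρ x) / ‖y - x‖) := by
        simp_rw [fun x => lintegral_add_left' (mk1 x)
          (fun y => ENNReal.ofReal (ρ y * min (ρ y) (ρ x) / ‖y - x‖))]
        rw [lintegral_add_left' mk.lintegral_prod_right']
        congr 1
        exact lintegral_lintegral_swap mk.prod_swap
    _ ≤ _ := by
        refine (add_le_add step step).trans_eq ?_
        rw [← two_mul, ← lintegral_const_mul' _ _ (by simp)]
        refine lintegral_congr fun x => ?_
        rw [mul_assoc 2, ENNReal.ofReal_mul zero_le_two, ENNReal.ofReal_ofNat]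

theorem enorm_coulomb_integral_le {ρ : Space → ℝ} (h0 : ∀ x, 0 ≤ ρ x) :
    ‖∫ x : Space, ∫ y : Space, ρ x * ρ y / ‖x - y‖‖ₑ ≤
      ∫⁻ x : Space, ∫⁻ y : Space, ENNReal.ofReal (ρ x * ρ y / ‖x - y‖) := by
  refine (enorm_integral_le_lintegral_enorm _).trans (lintegral_mono fun x => ?_)
  refine (enorm_integral_le_lintegral_enorm _).trans_eq (lintegral_congr fun y => ?_)
  exact Real.enorm_of_nonneg (div_nonneg (mul_nonneg (h0 x) (h0 y)) (norm_nonneg _))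

theorem PhiHyp.exists_mul_rpow_le {Φ Φ' : ℝ → ℝ} {n n' : ℝ} (hΦ : PhiHyp Φ Φ' n n')
    {K : ℝ} (hK : 0 ≤ K) :
    ∃ D : ℝ, ∀ t : ℝ, 0 ≤ t → K * t ^ (4 / 3 : ℝ) ≤ Φ t + D * t := by
  obtain ⟨C, hC, r₁, hgrowth⟩ := hΦ.growth
  have hδ : 0 < 1 / n - 1 / 3 := sub_pos.2 (one_div_lt_one_div_of_lt hΦ.n_pos hΦ.n_lt_three)
  obtain ⟨T, hT⟩ := eventually_atTop.1
    ((((tendsto_rpow_atTop hδ).const_mul_atTop hC).eventually_ge_atTop K).and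
      ((eventually_ge_atTop r₁).and (eventually_gt_atTop 0)))
  have hT0 : 0 < T := (hT T le_rfl).2.2
  refine ⟨K * T ^ (1 / 3 : ℝ), fun t ht => ?_⟩
  rcases le_total T t with h | h
  · obtain ⟨h1, h2, h3⟩ := hT t h
    have : K * t ^ (4 / 3 : ℝ) ≤ C * t ^ (1 + 1 / n) := by
      calc K * t ^ (4 / 3 : ℝ) ≤ C * t ^ (1 / n - 1 / 3) * t ^ (4 / 3 : ℝ) := by gcongr
        _ = C * t ^ (1 + 1 / n) := by
          rw [mul_assoc, ← Real.rpow_add h3]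
          ring_nf
    have h4 : 0 ≤ K * T ^ (1 / 3 : ℝ) * t := by positivity
    linarith [hgrowth t h2]
  · have : K * t ^ (4 / 3 : ℝ) ≤ K * T ^ (1 / 3 : ℝ) * t := by
      calc K * t ^ (4 / 3 : ℝ) = K * (t ^ (1 / 3 : ℝ) * t) := by
            rw [← Real.rpow_add_one' ht (by norm_num)]
            norm_num
        _ ≤ K * (T ^ (1 / 3 : ℝ) * t) := by gcongr
        _ = _ := by ring
    linarith [hΦ.nonneg ht]

theorem bddBelow_image_HCr {Φ Φ' : ℝ → ℝ} {n n' : ℝ} (hΦ : PhiHyp Φ Φ' n n')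
    {M : ℝ} (hM : 0 < M) : BddBelow (HCr Φ '' FMr Φ M) := by
  obtain ⟨D, hD⟩ := hΦ.exists_mul_rpow_le
    (K := 2 * (3 * volume.real (Metric.ball (0 : Space) 1) / 2 + M)) (by positivity)
  refine ⟨-|D * M|, ?_⟩
  rintro _ ⟨ρ, ⟨h0, hρ, hΦρ, hmass⟩, rfl⟩
  have hint : Integrable fun x => Φ (ρ x) + D * ρ x := hΦρ.add (hρ.const_mul D)
  have hnonneg (x : Space) : 0 ≤ Φ (ρ x) + D * ρ x :=
    (mul_nonneg (by positivity) (Real.rpow_nonneg (h0 x) _)).trans (hD _ (h0 x))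
  have hE : ‖∫ x : Space, ∫ y : Space, ρ x * ρ y / ‖x - y‖‖ ≤ (∫ x, Φ (ρ x)) + D * M := by
    have hle := (enorm_coulomb_integral_le h0).trans (lintegral_lintegral_coulomb_le h0 hρ)
    rw [hmass] at hle
    have hle' := hle.trans (lintegral_mono fun x => ENNReal.ofReal_le_ofReal (hD _ (h0 x)))
    rw [← ofReal_integral_eq_lintegral_ofReal hint (ae_of_all _ hnonneg),
      ← ofReal_norm, ENNReal.ofReal_le_ofReal_iff (integral_nonneg hnonneg),
      integral_add hΦρ (hρ.const_mul D), integral_const_mul, hmass] at hle'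
    exact hle'
  have h1 := (le_abs_self _).trans hE
  have h2 : 0 ≤ ∫ x, Φ (ρ x) := integral_nonneg fun x => hΦ.nonneg (h0 x)
  simp only [HCr, Epot]
  linarith [le_abs_self (D * M), abs_nonneg (D * M)]

theorem integrable_coulomb {ρ : Space → ℝ} (h0 : ∀ x, 0 ≤ ρ x) (hρ : Integrable ρ)
    (hρ' : Integrable fun x => ρ x ^ (4 / 3 : ℝ)) :
    Integrable (fun p : Space × Space => ρ p.1 * ρ p.2 / ‖p.1 - p.2‖) (volume.prod volume) := by
  have m1 : AEMeasurable (fun p : Space × Space => ρ p.1) (volume.prod volume) :=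
    hρ.1.aemeasurable.comp_fst
  have m2 : AEMeasurable (fun p : Space × Space => ρ p.2) (volume.prod volume) :=
    hρ.1.aemeasurable.comp_snd
  have hm : AEMeasurable (fun p : Space × Space => ρ p.1 * ρ p.2 / ‖p.1 - p.2‖)
      (volume.prod volume) := by
    fun_prop
  refine ⟨hm.aestronglyMeasurable, ?_⟩
  rw [hasFiniteIntegral_iff_ofReal (ae_of_all _ fun p =>
    div_nonneg (mul_nonneg (h0 _) (h0 _)) (norm_nonneg _)), lintegral_prod _ hm.ennreal_ofReal]
  refine (lintegral_lintegral_coulomb_le h0 hρ).trans_lt ?_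
  exact (hρ'.const_mul _).lintegral_lt_top

theorem sq_integral_div_le_coulomb {ρ : Space → ℝ} (h0 : ∀ x, 0 ≤ ρ x) (hρ : Integrable ρ)
    (hρ' : Integrable fun x => ρ x ^ (4 / 3 : ℝ)) {R : ℝ} (hsupp : ∀ x, ρ x ≠ 0 → ‖x‖ ≤ R) :
    (∫ x, ρ x) ^ 2 / (2 * R) ≤ ∫ x : Space, ∫ y : Space, ρ x * ρ y / ‖x - y‖ := by
  have hint := integrable_coulomb h0 hρ hρ'
  have hpt (x : Space) : ∀ᵐ y : Space, ρ x * ρ y / (2 * R) ≤ ρ x * ρ y / ‖x - y‖ := by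
    filter_upwards [Measure.ae_ne volume x] with y hy
    by_cases hxy : ρ x * ρ y = 0
    · simp [hxy]
    · have hx := hsupp x (left_ne_zero_of_mul hxy)
      have hy' := hsupp y (right_ne_zero_of_mul hxy)
      refine div_le_div_of_nonneg_left (mul_nonneg (h0 x) (h0 y))
        (norm_pos_iff.2 (sub_ne_zero.2 hy.symm)) ?_
      linarith [norm_sub_le x y]
  have hlow : ∫ x : Space, ∫ y : Space, ρ x * ρ y / (2 * R) = (∫ x, ρ x) ^ 2 / (2 * R) := by
    simp_rw [integral_div, integral_const_mul, integral_mul_const]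
    rw [sq]
  rw [← hlow]
  refine integral_mono_ae ?_ hint.integral_prod_left ?_
  · simp_rw [integral_div, integral_const_mul]
    exact (hρ.mul_const _).div_const _
  · filter_upwards [hint.prod_right_ae] with x hx
    exact integral_mono_ae ((hρ.const_mul _).div_const _) hx (hpt x)

theorem HCr_indicator_ball_le {Φ : ℝ → ℝ} (hΦ0 : Φ 0 = 0) {a M R : ℝ} (ha : 0 ≤ a)
    (hM : a * volume.real (Metric.ball (0 : Space) R) = M) :
    (Metric.ball (0 : Space) R).indicator (fun _ => a) ∈ FMr Φ M ∧
      HCr Φ ((Metric.ball (0 : Space) R).indicator fun _ => a) ≤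
        Φ a * volume.real (Metric.ball (0 : Space) R) - M ^ 2 / (4 * R) := by
  set B := Metric.ball (0 : Space) R
  have hcomp (g : ℝ → ℝ) (hg : g 0 = 0) :
      (fun x => g (B.indicator (fun _ => a) x)) = B.indicator fun _ => g a := by
    funext x
    by_cases hx : x ∈ B <;> simp [hx, hg]
  have hind (c : ℝ) : Integrable (B.indicator fun _ : Space => c) :=
    (integrable_indicator_iff measurableSet_ball).2
      (integrableOn_const measure_ball_lt_top.ne)
  have hval (c : ℝ) : ∫ x, B.indicator (fun _ : Space => c) x = c * volume.real B := by
    rw [integral_indicator_const c measurableSet_ball, smul_eq_mul, mul_comm]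
  have h0 (x : Space) : 0 ≤ B.indicator (fun _ => a) x := Set.indicator_nonneg (fun _ _ => ha) x
  refine ⟨⟨h0, hind a, ?_, (hval a).trans hM⟩, ?_⟩
  · rw [hcomp Φ hΦ0]
    exact hind _
  · have hpow : Integrable fun x => B.indicator (fun _ => a) x ^ (4 / 3 : ℝ) := by
      rw [hcomp (fun t => t ^ (4 / 3 : ℝ)) (Real.zero_rpow (by norm_num))]
      exact hind _
    have hE := sq_integral_div_le_coulomb h0 (hind a) hpow (R := R) fun x hx =>
      (mem_ball_zero_iff.1 (Set.mem_of_indicator_ne_zero hx)).le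
    rw [hval, hM] at hE
    rw [HCr, Epot, hcomp Φ hΦ0, hval]
    have : M ^ 2 / (4 * R) = 1 / 2 * (M ^ 2 / (2 * R)) := by ring
    linarith

theorem exists_HCr_neg {Φ Φ' : ℝ → ℝ} {n n' : ℝ} (hΦ : PhiHyp Φ Φ' n n')
    {M : ℝ} (hM : 0 < M) : ∃ ρ ∈ FMr Φ M, HCr Φ ρ < 0 := by
  obtain ⟨C, hC, r₁, hr₁, hsmall⟩ := hΦ.small
  have hv : 0 < volume.real (Metric.ball (0 : Space) 1) :=
    ENNReal.toReal_pos (Metric.measure_ball_pos _ _ one_pos).ne' measure_ball_lt_top.ne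
  set v := volume.real (Metric.ball (0 : Space) 1)
  have hδ : 0 < 1 / n' - 1 / 3 := sub_pos.2 (one_div_lt_one_div_of_lt hΦ.n'_pos hΦ.n'_lt_three)
  have hlim : Tendsto (fun a : ℝ => C * a ^ (1 / n' - 1 / 3)) (𝓝[>] 0) (𝓝 0) := by
    have h := ((Real.continuousAt_rpow_const 0 _ (Or.inr hδ.le)).const_mul C).tendsto
    rw [Real.zero_rpow hδ.ne', mul_zero] at h
    exact h.mono_left nhdsWithin_le_nhds
  have hK : 0 < M / 4 * (v / M) ^ (1 / 3 : ℝ) := by positivity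
  obtain ⟨a, hlt, ha, har⟩ := ((hlim.eventually_lt_const hK).and
    (Ioc_mem_nhdsGT hr₁)).exists
  set R := (M / (v * a)) ^ (1 / 3 : ℝ)
  have hR : 0 < R := by positivity
  have hR3 : R ^ 3 = M / (v * a) := by
    rw [← Real.rpow_natCast, ← Real.rpow_mul (by positivity)]
    norm_num
  have hvol : volume.real (Metric.ball (0 : Space) R) = R ^ 3 * v := by
    rw [measureReal_def, Measure.addHaar_ball _ _ hR.le, finrank_euclideanSpace_fin,
      ENNReal.toReal_mul, ENNReal.toReal_ofReal (by positivity)]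
    rfl
  have hmass : a * volume.real (Metric.ball (0 : Space) R) = M := by
    rw [hvol, hR3]
    field_simp
  obtain ⟨hmem, hle⟩ := HCr_indicator_ball_le hΦ.zero ha.le hmass
  refine ⟨_, hmem, hle.trans_lt ?_⟩
  have hRinv : (v / M) ^ (1 / 3 : ℝ) * a ^ (1 / 3 : ℝ) = 1 / R := by
    rw [← Real.mul_rpow (by positivity) ha.le, one_div R, ← Real.inv_rpow (by positivity)]
    congr 1
    field_simp
  have hpow : a ^ (1 + 1 / n') = a ^ (1 / n' - 1 / 3) * a ^ (1 / 3 : ℝ) * a := by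
    rw [← Real.rpow_add ha, ← Real.rpow_add_one ha.ne']
    ring_nf
  have ha3 : 0 < a ^ (1 / 3 : ℝ) := by positivity
  rw [sub_neg]
  calc Φ a * volume.real (Metric.ball (0 : Space) R)
      ≤ C * a ^ (1 + 1 / n') * volume.real (Metric.ball (0 : Space) R) := by
        gcongr
        exact hsmall a ha.le har
    _ = C * a ^ (1 / n' - 1 / 3) * (a ^ (1 / 3 : ℝ) * M) := by
        rw [hpow, ← hmass]
        ring
    _ < M / 4 * (v / M) ^ (1 / 3 : ℝ) * (a ^ (1 / 3 : ℝ) * M) := by gcongr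
    _ = M ^ 2 / 4 * ((v / M) ^ (1 / 3 : ℝ) * a ^ (1 / 3 : ℝ)) := by ring
    _ = M ^ 2 / (4 * R) := by
        rw [hRinv]
        field_simp

/-- For every `M > 0`, `h_M^r < 0`. -/
theorem hMr_neg (Φ Φ' : ℝ → ℝ) (n n' : ℝ) (hΦ : PhiHyp Φ Φ' n n')
    (M : ℝ) (hM : 0 < M) :
    hMr Φ M < 0 := by
  obtain ⟨ρ, hρ, hneg⟩ := exists_HCr_neg hΦ hM
  exact csInf_lt_of_lt (bddBelow_image_HCr hΦ hM) (Set.mem_image_of_mem _ hρ) hneg
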